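/- arXiv:cs/0408027 — 5 statements merged into one kernel-verified Lean document; each statement's English description precedes it below -/
import Mathlib

section
/- Let R be a set of ground propagation rules over a type α and Q : Set α a query. If a state S is reachable from Q by derivation steps and S is final (no derivation step applies to S), then S = cl R Q, the inductive closure of Q under R. In particular, all final states of derivations from Q coincide, and they equal the least Herbrand model of the rules together with Q, i.e. the least set containing Q and closed under R. -/
/-- The inductive closure of a query `Q` under a set `R` of ground propagation rules. -/
inductive cl {α : Type*} (R : Set (Finset α × Finset α)) (Q : Set α) : α → Prop
  | base {a : α} : a ∈ Q → cl R Q a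
  | step {H B : Finset α} {b : α} :
      (H, B) ∈ R → (∀ a ∈ H, cl R Q a) → b ∈ B → cl R Q b

/-- A derivation step: apply a rule `(H, B) ∈ R` whose head is contained in the state
and whose body is not yet contained, adding the body. -/
def Step {α : Type*} (R : Set (Finset α × Finset α)) (S S' : Set α) : Prop :=
  ∃ H B : Finset α, (H, B) ∈ R ∧ ↑H ⊆ S ∧ ¬(↑B ⊆ S) ∧ S' = S ∪ ↑B

theorem Step.subset_cl {α : Type*} {R : Set (Finset α × Finset α)} {Q S S' : Set α}
    (h : Step R S S') (hS : S ⊆ {a | cl R Q a}) : S' ⊆ {a | cl R Q a} := by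
  obtain ⟨H, B, hR, hH, -, rfl⟩ := h
  exact Set.union_subset hS fun b hb => cl.step hR (fun a ha => hS (hH ha)) hb

theorem Step.subset {α : Type*} {R : Set (Finset α × Finset α)} {S S' : Set α}
    (h : Step R S S') : S ⊆ S' := by
  obtain ⟨H, B, -, -, -, rfl⟩ := h
  exact Set.subset_union_left

theorem cl_subset_of_closed {α : Type*} {R : Set (Finset α × Finset α)} {Q S : Set α}
    (hQ : Q ⊆ S) (hR : ∀ H B : Finset α, (H, B) ∈ R → ↑H ⊆ S → ↑B ⊆ S) :
    {a | cl R Q a} ⊆ S := by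
  intro a ha
  induction ha with
  | base h => exact hQ h
  | step hmem _ hb ih => exact hR _ _ hmem (fun a ha => ih a ha) hb

theorem final_state_eq_closure {α : Type*} (R : Set (Finset α × Finset α)) (Q S : Set α)
    (hreach : Relation.ReflTransGen (Step R) Q S)
    (hfinal : ∀ S' : Set α, ¬ Step R S S') :
    S = {a : α | cl R Q a} := by
  apply Set.Subset.antisymm
  · clear hfinal
    induction hreach with
    | refl => exact fun a ha => cl.base ha
    | tail _ h ih => exact h.subset_cl ih
  · refine cl_subset_of_closed ?_ fun H B hR hH => ?_
    · clear hfinal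
      induction hreach with
      | refl => exact subset_rfl
      | tail _ h ih => exact ih.trans h.subset
    · by_contra hB
      exact hfinal _ ⟨H, B, hR, hH, hB, rfl⟩
end

section
/- Let R be a set of ground simplification/simpagation rules over a type α, i.e. triples (H, H', B) of finite sets of elements of α with H' ⊆ H, and let R̂ = {(H, B) | ∃ H', (H, H', B) ∈ R} be its propagation projection. Then every state S reachable from a query Q : Set α by simplification steps satisfies S ⊆ cl R̂ Q. -/
/-- A simplification/simpagation step: apply a rule `(H, H', B) ∈ R` whose head is
contained in the state, removing the removed part `H'` of the head and adding the body. -/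
def SimpStep {α : Type*} (R : Set (Finset α × Finset α × Finset α)) (S S' : Set α) : Prop :=
  ∃ H H' B : Finset α, (H, H', B) ∈ R ∧ ↑H ⊆ S ∧ S' = (S \ ↑H') ∪ ↑B

theorem simplification_subset_propagation_closure {α : Type*}
    (R : Set (Finset α × Finset α × Finset α))
    (hR : ∀ H H' B : Finset α, (H, H', B) ∈ R → H' ⊆ H)
    (Q S : Set α) (hreach : Relation.ReflTransGen (SimpStep R) Q S) :
    S ⊆ {a : α | cl {p : Finset α × Finset α | ∃ H' : Finset α, (p.1, H', p.2) ∈ R} Q a} := by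
  induction hreach with
  | refl => exact fun a ha => cl.base ha
  | tail _ hstep ih =>
    obtain ⟨H, H', B, hrule, hH, rfl⟩ := hstep
    rintro a (ha | ha)
    · exact ih ha.1
    · exact cl.step ⟨H', hrule⟩ (fun b hb => ih (hH hb)) ha
end

section
/- Let R be a set of ground abductive grammar rules over phrase atoms Φ and context atoms Γ, D : Set Φ a discourse, X : Set Γ a context, and Ph : Set Φ with Ph ⊆ cl R X D. Suppose X is minimal with this property, in the sense that for every x ∈ X one has ¬(Ph ⊆ cl R (X \ {x}) D). Then every context fact is used: for every x ∈ X there exists a rule (c, f, p) ∈ R with ↑c ⊆ cl R X D, ↑f ⊆ X, and x ∈ f. -/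
/-- The phrase closure of a discourse `D` under abductive grammar rules `R`,
relative to a context `X`. -/
inductive acl {Φ Γ : Type*} (R : Set (Finset Φ × Finset Γ × Φ)) (X : Set Γ) (D : Set Φ) :
    Φ → Prop
  | base {a : Φ} : a ∈ D → acl R X D a
  | step {c : Finset Φ} {f : Finset Γ} {p : Φ} :
      (c, f, p) ∈ R → (∀ a ∈ c, acl R X D a) → ↑f ⊆ X → acl R X D p

/-- A context fact that no applicable rule uses can be dropped from the context. -/
theorem acl.diff_singleton_of_unused {Φ Γ : Type*} {R : Set (Finset Φ × Finset Γ × Φ)}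
    {X : Set Γ} {D : Set Φ} {x : Γ}
    (hx : ∀ (c : Finset Φ) (f : Finset Γ) (p : Φ),
      (c, f, p) ∈ R → (∀ a ∈ c, acl R X D a) → ↑f ⊆ X → x ∉ f)
    {a : Φ} (ha : acl R X D a) : acl R (X \ {x}) D a := by
  induction ha with
  | base h => exact .base h
  | step hR hc hf ih =>
    exact .step hR ih (Set.subset_sdiff_singleton hf (hx _ _ _ hR hc hf))

theorem minimal_context_every_fact_used {Φ Γ : Type*}
    (R : Set (Finset Φ × Finset Γ × Φ)) (D : Set Φ) (X : Set Γ) (Ph : Set Φ)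
    (hPh : Ph ⊆ {a : Φ | acl R X D a})
    (hmin : ∀ x ∈ X, ¬(Ph ⊆ {a : Φ | acl R (X \ {x}) D a})) :
    ∀ x ∈ X, ∃ (c : Finset Φ) (f : Finset Γ) (p : Φ),
      (c, f, p) ∈ R ∧ ↑c ⊆ {a : Φ | acl R X D a} ∧ ↑f ⊆ X ∧ x ∈ f := by
  intro x hx
  by_contra hunused
  refine hmin x hx fun a ha => acl.diff_singleton_of_unused ?_ (hPh ha)
  exact fun c f p hR hc hf hxf => hunused ⟨c, f, p, hR, hc, hf, hxf⟩
end

section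
/- Let R be a set of ground abductive grammar rules over phrase atoms Φ and context atoms Γ, and D : Set Φ a discourse. If a pair (C, F) is T-reachable from (D, ∅), then C ⊆ cl R F D; that is, every phrase produced by the transformed (deductive) grammar is derivable from the discourse using only the context facts F abduced along the way. -/
/-- The abductive T-step relation of the transformed (deductive) grammar:
whenever the constituents of a rule are present, add the produced phrase and
abduce the rule's context facts. -/
def TStep {Φ Γ : Type*} (R : Set (Finset Φ × Finset Γ × Φ)) :
    Set Φ × Set Γ → Set Φ × Set Γ → Prop :=
  fun s s' => ∃ (c : Finset Φ) (f : Finset Γ) (p : Φ),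
    (c, f, p) ∈ R ∧ ↑c ⊆ s.1 ∧ s' = (s.1 ∪ {p}, s.2 ∪ ↑f)

/-- The phrase closure is monotone in the context. -/
theorem acl.mono {Φ Γ : Type*} {R : Set (Finset Φ × Finset Γ × Φ)} {X Y : Set Γ} {D : Set Φ}
    (hXY : X ⊆ Y) {a : Φ} (h : acl R X D a) : acl R Y D a := by
  induction h with
  | base ha => exact .base ha
  | step hR _ hf ih => exact .step hR ih (hf.trans hXY)

/-- A T-step preserves derivability of all phrases from the abduced context. -/
theorem TStep.subset_acl {Φ Γ : Type*} {R : Set (Finset Φ × Finset Γ × Φ)} {D : Set Φ}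
    {s t : Set Φ × Set Γ} (hst : TStep R s t) (hs : s.1 ⊆ {a | acl R s.2 D a}) :
    t.1 ⊆ {a | acl R t.2 D a} := by
  obtain ⟨c, f, p, hR, hc, rfl⟩ := hst
  rintro a (ha | rfl)
  · exact (hs ha).mono Set.subset_union_left
  · exact acl.step hR (fun b hb => (hs (hc hb)).mono Set.subset_union_left) Set.subset_union_right

theorem transformed_grammar_sound {Φ Γ : Type*}
    (R : Set (Finset Φ × Finset Γ × Φ)) (D : Set Φ) (C : Set Φ) (F : Set Γ)
    (hreach : Relation.ReflTransGen (TStep R) (D, ∅) (C, F)) :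
    C ⊆ {a : Φ | acl R F D a} := by
  suffices ∀ s, Relation.ReflTransGen (TStep R) (D, ∅) s → s.1 ⊆ {a | acl R s.2 D a} from
    this _ hreach
  intro s hs
  induction hs with
  | refl => exact fun _ ha => acl.base ha
  | tail _ hst ih => exact hst.subset_acl ih
end

section
/- Let R be a set of ground abductive grammar rules over phrase atoms Φ and context atoms Γ, D : Set Φ a discourse, and let Ph : Set Φ and X : Set Γ be finite with Ph ⊆ cl R X D. Suppose X is minimal with this property, in the sense that for every x ∈ X one has ¬(Ph ⊆ cl R (X \ {x}) D). Then there exists a pair (C, F) that is T-reachable from (D, ∅) with Ph ⊆ C and F = X. -/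
theorem TStep.fst_subset {Φ Γ : Type*} {R : Set (Finset Φ × Finset Γ × Φ)}
    {s t : Set Φ × Set Γ} (h : Relation.ReflTransGen (TStep R) s t) : s.1 ⊆ t.1 := by
  induction h with
  | refl => exact subset_rfl
  | tail _ hstep ih =>
    obtain ⟨c, f, p, _, _, rfl⟩ := hstep
    exact ih.trans Set.subset_union_left

/-- Every phrase of a reachable pair is in the closure relative to the abduced context. -/
theorem TStep.sound {Φ Γ : Type*} {R : Set (Finset Φ × Finset Γ × Φ)} {D : Set Φ}
    {s : Set Φ × Set Γ} (h : Relation.ReflTransGen (TStep R) (D, ∅) s) :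
    ∀ a ∈ s.1, acl R s.2 D a := by
  induction h with
  | refl => exact fun a ha => .base ha
  | tail _ hstep ih =>
    obtain ⟨c, f, p, hr, hc, rfl⟩ := hstep
    rintro a (ha | rfl)
    · exact (ih a ha).mono Set.subset_union_left
    · exact .step hr (fun b hb => (ih b (hc hb)).mono Set.subset_union_left)
        Set.subset_union_right

/-- If each element of a finite set can be produced from any pair whose context lies in `X`,
then all of them can be produced together. -/
theorem TStep.exists_finset_subset {Φ Γ : Type*} {R : Set (Finset Φ × Finset Γ × Φ)} {X : Set Γ}
    {D : Set Φ} (c : Finset Φ)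
    (h : ∀ a ∈ c, ∀ s : Set Φ × Set Γ, D ⊆ s.1 → s.2 ⊆ X →
      ∃ t, Relation.ReflTransGen (TStep R) s t ∧ a ∈ t.1 ∧ t.2 ⊆ X)
    (s : Set Φ × Set Γ) (hD : D ⊆ s.1) (hX : s.2 ⊆ X) :
    ∃ t, Relation.ReflTransGen (TStep R) s t ∧ ↑c ⊆ t.1 ∧ t.2 ⊆ X := by
  classical
  induction c using Finset.induction_on with
  | empty => exact ⟨s, .refl, by simp, hX⟩
  | insert a c _ ih =>
    obtain ⟨t, hst, hct, htX⟩ := ih fun b hb => h b (Finset.mem_insert_of_mem hb)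
    obtain ⟨u, htu, hau, huX⟩ :=
      h a (Finset.mem_insert_self a c) t (hD.trans (fst_subset hst)) htX
    refine ⟨u, hst.trans htu, ?_, huX⟩
    rw [Finset.coe_insert]
    exact Set.insert_subset hau (hct.trans (fst_subset htu))

theorem acl.exists_reachable {Φ Γ : Type*} {R : Set (Finset Φ × Finset Γ × Φ)} {X : Set Γ}
    {D : Set Φ} {a : Φ} (h : acl R X D a) :
    ∀ s : Set Φ × Set Γ, D ⊆ s.1 → s.2 ⊆ X →
      ∃ t, Relation.ReflTransGen (TStep R) s t ∧ a ∈ t.1 ∧ t.2 ⊆ X := by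
  induction h with
  | base ha => exact fun s hD hX => ⟨s, .refl, hD ha, hX⟩
  | @step c f p hr _ hf ih =>
    intro s hD hX
    obtain ⟨t, hst, hct, htX⟩ := TStep.exists_finset_subset c ih s hD hX
    exact ⟨_, hst.tail ⟨c, f, p, hr, hct, rfl⟩, Or.inr rfl, Set.union_subset htX hf⟩

theorem transformed_grammar_complete {Φ Γ : Type*}
    (R : Set (Finset Φ × Finset Γ × Φ)) (D : Set Φ) (Ph : Set Φ) (X : Set Γ)
    (hPhfin : Ph.Finite) (hXfin : X.Finite)
    (hPh : Ph ⊆ {a : Φ | acl R X D a})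
    (hmin : ∀ x ∈ X, ¬(Ph ⊆ {a : Φ | acl R (X \ {x}) D a})) :
    ∃ (C : Set Φ) (F : Set Γ),
      Relation.ReflTransGen (TStep R) (D, ∅) (C, F) ∧ Ph ⊆ C ∧ F = X := by
  obtain ⟨⟨C, F⟩, hreach, hC, hF⟩ := TStep.exists_finset_subset hPhfin.toFinset
    (fun a ha => (hPh (hPhfin.mem_toFinset.1 ha)).exists_reachable)
    (D, ∅) subset_rfl (Set.empty_subset X)
  rw [hPhfin.coe_toFinset] at hC
  refine ⟨C, F, hreach, hC, hF.antisymm fun x hx => ?_⟩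
  by_contra hxF
  exact hmin x hx fun a ha =>
    (TStep.sound hreach a (hC ha)).mono (Set.subset_sdiff_singleton hF hxF)
end
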